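/- arXiv:1311.0796 — 4 statements merged into one kernel-verified Lean document; each statement's English description precedes it below -/
import Mathlib

section
/- Let C and D be categories, let F : C ⥤ D be left adjoint to U : D ⥤ C with unit η and counit ε, and let P : C ⥤ C and Q : D ⥤ D be functors. Let κ : U ⋙ P ⟶ Q ⋙ U be a natural transformation (so κ.app M : P.obj (U.obj M) ⟶ U.obj (Q.obj M) for M in D), and let μ : P ⋙ F ⟶ F ⋙ Q be its mate, with components μ.app N = F.map (P.map (η.app N)) ≫ F.map (κ.app (F.obj N)) ≫ ε.app (Q.obj (F.obj N)) : F.obj (P.obj N) ⟶ Q.obj (F.obj N). Assume μ is a natural isomorphism. If an object M of D is a retract of F.obj N for some object N of C, then Q.obj M is a retract of F.obj (P.obj (U.obj M)). -/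
open CategoryTheory

/-- If the mate `μ : P ⋙ F ⟶ F ⋙ Q` of `κ : U ⋙ P ⟶ Q ⋙ U` is a natural
isomorphism and `M` is a retract of `F.obj N`, then `Q.obj M` is a retract of
`F.obj (P.obj (U.obj M))`. -/
theorem retract_of_mate_iso
    {C : Type*} [Category C] {D : Type*} [Category D]
    (F : C ⥤ D) (U : D ⥤ C) (adj : F ⊣ U)
    (P : C ⥤ C) (Q : D ⥤ D)
    (κ : U ⋙ P ⟶ Q ⋙ U) (μ : P ⋙ F ⟶ F ⋙ Q)
    (hμ : ∀ N : C, μ.app N =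
      F.map (P.map (adj.unit.app N)) ≫ F.map (κ.app (F.obj N)) ≫
        adj.counit.app (Q.obj (F.obj N)))
    (hiso : IsIso μ)
    (M : D) (N : C) (s : M ⟶ F.obj N) (r : F.obj N ⟶ M) (hsr : s ≫ r = 𝟙 M) :
    ∃ (s' : Q.obj M ⟶ F.obj (P.obj (U.obj M)))
      (r' : F.obj (P.obj (U.obj M)) ⟶ Q.obj M),
      s' ≫ r' = 𝟙 (Q.obj M) := by
  have hκ : F.map (P.map (U.map r)) ≫ F.map (κ.app M) =
      F.map (κ.app (F.obj N)) ≫ F.map (U.map (Q.map r)) := by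
    rw [← F.map_comp, ← F.map_comp]
    exact congrArg F.map (κ.naturality r)
  have hε : F.map (U.map (Q.map r)) ≫ adj.counit.app (Q.obj M) =
      adj.counit.app (Q.obj (F.obj N)) ≫ Q.map r :=
    adj.counit.naturality (Q.map r)
  have hfac : (F.map (P.map (adj.unit.app N)) ≫ F.map (P.map (U.map r))) ≫
      F.map (κ.app M) ≫ adj.counit.app (Q.obj M) = μ.app N ≫ Q.map r := by
    rw [hμ N, Category.assoc, reassoc_of% hκ, hε]
    simp only [Category.assoc]
  refine ⟨Q.map s ≫ inv (μ.app N) ≫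
    F.map (P.map (adj.unit.app N)) ≫ F.map (P.map (U.map r)),
    F.map (κ.app M) ≫ adj.counit.app (Q.obj M), ?_⟩
  calc
    _ = Q.map s ≫ inv (μ.app N) ≫ μ.app N ≫ Q.map r := by
      rw [← hfac]
      simp only [Category.assoc]
    _ = Q.map s ≫ Q.map r := by
      rw [IsIso.inv_hom_id_assoc]
    _ = 𝟙 (Q.obj M) := by
      rw [← Q.map_comp, hsr, Q.map_id]
end

section
/- Let C and D be categories, let F : C ⥤ D be left adjoint to U : D ⥤ C with unit η and counit ε, and let P : C ⥤ C and Q : D ⥤ D be functors. Let κ : U ⋙ P ⟶ Q ⋙ U be a natural transformation, and let μ : P ⋙ F ⟶ F ⋙ Q be its mate, with components μ.app N = F.map (P.map (η.app N)) ≫ F.map (κ.app (F.obj N)) ≫ ε.app (Q.obj (F.obj N)). Assume μ is a natural isomorphism, and assume an object M of D is a retract of F.obj N for some object N of C. Then the function from Hom_D(Q.obj M, M) to Hom_C(P.obj (U.obj M), U.obj M) sending f to κ.app M ≫ U.map f is injective. In particular, any morphism Q.obj M ⟶ M is uniquely determined by the induced morphism P.obj (U.obj M) ⟶ U.obj M.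 -/
open CategoryTheory

/-- Under the hypotheses of the Lemma, the map `f ↦ κ.app M ≫ U.map f` from
`Hom(Q.obj M, M)` to `Hom(P.obj (U.obj M), U.obj M)` is injective: any morphism
`Q.obj M ⟶ M` is determined by the induced morphism `P.obj (U.obj M) ⟶ U.obj M`. -/
theorem hom_determined_of_mate_iso
    {C : Type*} [Category C] {D : Type*} [Category D]
    (F : C ⥤ D) (U : D ⥤ C) (adj : F ⊣ U)
    (P : C ⥤ C) (Q : D ⥤ D)
    (κ : U ⋙ P ⟶ Q ⋙ U) (μ : P ⋙ F ⟶ F ⋙ Q)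
    (hμ : ∀ N : C, μ.app N =
      F.map (P.map (adj.unit.app N)) ≫ F.map (κ.app (F.obj N)) ≫
        adj.counit.app (Q.obj (F.obj N)))
    (hiso : IsIso μ)
    (M : D) (N : C) (s : M ⟶ F.obj N) (r : F.obj N ⟶ M) (hsr : s ≫ r = 𝟙 M) :
    Function.Injective (fun f : Q.obj M ⟶ M => κ.app M ≫ U.map f) := by
  intro f g hfg
  have hκ (h : Q.obj M ⟶ M) : κ.app (F.obj N) ≫ U.map (Q.map r ≫ h) =
      P.map (U.map r) ≫ κ.app M ≫ U.map h := by
    have := κ.naturality_assoc r (U.map h)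
    simpa using this.symm
  have h_mate (k : Q.obj (F.obj N) ⟶ M) : μ.app N ≫ k =
      F.map (P.map (adj.unit.app N)) ≫ F.map (κ.app (F.obj N) ≫ U.map k) ≫
        adj.counit.app M := by
    simp [hμ]
  have hr : Q.map r ≫ f = Q.map r ≫ g := by
    rw [← cancel_epi (μ.app N), h_mate, h_mate, hκ, hκ]
    exact congrArg (fun k => F.map (P.map (adj.unit.app N)) ≫
      F.map (P.map (U.map r) ≫ k) ≫ adj.counit.app M) hfg
  have hQ : Q.map s ≫ Q.map r = 𝟙 (Q.obj M) := by
    rw [← Q.map_comp, hsr, Q.map_id]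
  calc
    f = Q.map s ≫ Q.map r ≫ f := by rw [← Category.assoc, hQ, Category.id_comp]
    _ = Q.map s ≫ Q.map r ≫ g := by rw [hr]
    _ = g := by rw [← Category.assoc, hQ, Category.id_comp]
end

section
/- Let n be a natural number with n ≥ 2. Then n is a power of 2 (there exists k with n = 2^k) if and only if for all natural numbers a and b with a + b = n, 0 < a, and a < 2 * b, the binomial coefficient (b − 1).choose a is even. -/
/-- The parity of a binomial coefficient, split along the last binary digits (Lucas). -/
theorem even_choose_iff_mod_two_div_two (n k : ℕ) :
    Even (n.choose k) ↔ Even ((n % 2).choose (k % 2)) ∨ Even ((n / 2).choose (k / 2)) := by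
  have h : n.choose k ≡ (n % 2).choose (k % 2) * (n / 2).choose (k / 2) [MOD 2] :=
    Choose.choose_modEq_choose_mod_mul_choose_div_nat
  rw [← Nat.even_mul, Nat.even_iff, Nat.even_iff, h]

theorem even_choose_two_pow_sub_one_sub (k a : ℕ) (ha : 0 < a) (hak : a < 2 ^ k) :
    Even ((2 ^ k - 1 - a).choose a) := by
  induction k generalizing a with
  | zero => simp at hak; omega
  | succ k ih =>
    rw [pow_succ] at hak ⊢
    rw [even_choose_iff_mod_two_div_two]
    rcases Nat.mod_two_eq_zero_or_one a with h | h
    · right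
      rw [show (2 ^ k * 2 - 1 - a) / 2 = 2 ^ k - 1 - a / 2 by omega]
      exact ih _ (by omega) (by omega)
    · left
      rw [h, show (2 ^ k * 2 - 1 - a) % 2 = 0 by omega]
      simp

theorem not_even_choose_two_pow_sub_one (k a : ℕ) (hak : a < 2 ^ k) :
    ¬ Even ((2 ^ k - 1).choose a) := by
  induction k generalizing a with
  | zero => simp at hak; simp [hak]
  | succ k ih =>
    rw [pow_succ] at hak ⊢
    have hk : 0 < 2 ^ k := by positivity
    rw [even_choose_iff_mod_two_div_two, show (2 ^ k * 2 - 1) / 2 = 2 ^ k - 1 by omega,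
      show (2 ^ k * 2 - 1) % 2 = 1 by omega]
    rintro (h | h)
    · rcases Nat.mod_two_eq_zero_or_one a with h' | h' <;> simp [h'] at h
    · exact ih _ (by omega) h

/-- `n ≥ 2` is a power of `2` iff every Adem-relation coefficient
`C(b - 1, a)` with `a + b = n`, `0 < a`, `a < 2 * b` is even. -/
theorem pow_two_iff_adem_coeffs_even (n : ℕ) (hn : 2 ≤ n) :
    (∃ k : ℕ, n = 2 ^ k) ↔
      ∀ a b : ℕ, a + b = n → 0 < a → a < 2 * b → Even ((b - 1).choose a) := by
  constructor
  · rintro ⟨k, rfl⟩ a b hab ha hlt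
    rw [show b - 1 = 2 ^ k - 1 - a by omega]
    exact even_choose_two_pow_sub_one_sub k a ha (by omega)
  · intro h
    have hle : 2 ^ Nat.log 2 n ≤ n := Nat.pow_log_le_self 2 (by omega)
    have hlt : n < 2 ^ (Nat.log 2 n + 1) := Nat.lt_pow_succ_log_self (by norm_num) n
    rw [pow_succ] at hlt
    by_contra hne
    have hne' : n ≠ 2 ^ Nat.log 2 n := fun e => hne ⟨_, e⟩
    exact not_even_choose_two_pow_sub_one (Nat.log 2 n) (n - 2 ^ Nat.log 2 n) (by omega)
      (h _ _ (by omega) (by omega) (by omega))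
end

section
/- For every natural number k ≥ 1 and every natural number a with 0 < a < 2^k, the binomial coefficient (2^k − a − 1).choose a is even. -/
/-- For `k ≥ 1` and `0 < a < 2^k`, the binomial coefficient
`C(2^k - a - 1, a)` is even. -/
theorem adem_coeff_even_of_pow_two (k : ℕ) (hk : 1 ≤ k) (a : ℕ)
    (ha : 0 < a) (ha' : a < 2 ^ k) :
    Even ((2 ^ k - a - 1).choose a) := by
  clear hk
  induction k generalizing a with
  | zero => omega
  | succ k ih =>
    have lucas := Choose.choose_modEq_choose_mod_mul_choose_div_nat
      (n := 2 ^ (k + 1) - a - 1) (k := a) (p := 2)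
    rw [Nat.even_iff, lucas]
    rw [pow_succ] at ha' ⊢
    rcases Nat.mod_two_eq_zero_or_one a with h | h
    · have hmod : (2 ^ k * 2 - a - 1) % 2 = 1 := by omega
      have hdiv : (2 ^ k * 2 - a - 1) / 2 = 2 ^ k - a / 2 - 1 := by omega
      rw [hmod, hdiv, h, Nat.choose_zero_right, one_mul]
      exact Nat.even_iff.mp (ih (a / 2) (by omega) (by omega))
    · have hmod : (2 ^ k * 2 - a - 1) % 2 = 0 := by omega
      simp [hmod, h]
end
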